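/- arXiv:1303.4225 — 3 statements merged into one kernel-verified Lean document; each statement's English description precedes it below -/
import Mathlib

section
/- Suppose (u₀, u₁) ≢ 0. Then the problem 2∂_q∂_τ V + V ∂_q²V − (∂_q V)(∂_q²V) = 0 for (q,τ) ∈ ℝ × [0, τ₀), with initial condition V(q, 0) = F₀(q) and with supp V(·, τ) ⊆ {q ≤ M} for each τ, has a C^∞ solution V on ℝ × [0, τ₀). -/
open Set Filter MeasureTheory

noncomputable section

/-- `F₀(s) = (1/2)(s u₀(s) + ∫_s^∞ ρ u₁(ρ) dρ)` -/
def F0 (u₀ u₁ : ℝ → ℝ) (s : ℝ) : ℝ := (1 / 2) * (s * u₀ s + ∫ ρ in Set.Ioi s, ρ * u₁ ρ)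

/-- `τ(s) = (2/F₀'(s)) ln (F₀''(s)/(F₀''(s) - F₀'(s)))` -/
def tauOf (u₀ u₁ : ℝ → ℝ) (s : ℝ) : ℝ :=
  (2 / deriv (F0 u₀ u₁) s) *
    Real.log (deriv (deriv (F0 u₀ u₁)) s / (deriv (deriv (F0 u₀ u₁)) s - deriv (F0 u₀ u₁) s))

def setA (M : ℝ) (u₀ u₁ : ℝ → ℝ) : Set ℝ :=
  {s | s ∈ Set.Ioo (-M) M ∧ deriv (F0 u₀ u₁) s ≠ 0 ∧
    0 < deriv (deriv (F0 u₀ u₁)) s / (deriv (deriv (F0 u₀ u₁)) s - deriv (F0 u₀ u₁) s) ∧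
    0 < tauOf u₀ u₁ s}

def setB (M : ℝ) (u₀ u₁ : ℝ → ℝ) : Set ℝ :=
  {s | s ∈ Set.Ioo (-M) M ∧ deriv (F0 u₀ u₁) s = 0 ∧ 0 < deriv (deriv (F0 u₀ u₁)) s}

/-- `τ₀ = min { min_{s ∈ A} τ(s), min_{s ∈ B} 2/F₀''(s) }` -/
def tau0 (M : ℝ) (u₀ u₁ : ℝ → ℝ) : ℝ :=
  sInf (tauOf u₀ u₁ '' setA M u₀ u₁ ∪
    (fun s => 2 / deriv (deriv (F0 u₀ u₁)) s) '' setB M u₀ u₁)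

theorem hasFDerivAt_intervalIntegral_of_contDiff {E F : Type*}
    [NormedAddCommGroup E] [NormedSpace ℝ E] [FiniteDimensional ℝ E]
    [NormedAddCommGroup F] [NormedSpace ℝ F] {f : E × ℝ → F} (hf : ContDiff ℝ 1 f)
    (a b : ℝ) (x : E) :
    HasFDerivAt (fun x => ∫ t in a..b, f (x, t))
      (∫ t in a..b, (fderiv ℝ f (x, t)).comp (ContinuousLinearMap.inl ℝ E ℝ)) x := by
  have hc : Continuous fun p : E × ℝ =>
      (fderiv ℝ f p).comp (ContinuousLinearMap.inl ℝ E ℝ) :=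
    (hf.continuous_fderiv one_ne_zero).clm_comp continuous_const
  obtain ⟨C, hC⟩ := (((isCompact_closedBall x 1).prod (isCompact_uIcc (a := a) (b := b))).image
    hc.norm).bddAbove
  have hfc (y : E) : Continuous fun t => f (y, t) := hf.continuous.comp (by fun_prop)
  refine intervalIntegral.hasFDerivAt_integral_of_dominated_of_fderiv_le
    (F := fun y t => f (y, t))
    (F' := fun y t => (fderiv ℝ f (y, t)).comp (ContinuousLinearMap.inl ℝ E ℝ))
    (bound := fun _ => C) (Metric.closedBall_mem_nhds x one_pos)
    (Eventually.of_forall fun y => (hfc y).aestronglyMeasurable)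
    ((hfc x).intervalIntegrable _ _) ?_ ?_ intervalIntegrable_const ?_
  · exact (hc.comp (by fun_prop : Continuous fun t : ℝ => (x, t))).aestronglyMeasurable
  · exact Eventually.of_forall fun t ht y hy =>
      hC ⟨(y, t), ⟨hy, uIoc_subset_uIcc ht⟩, rfl⟩
  · refine Eventually.of_forall fun t _ y _ => ?_
    have h := (hf.differentiable one_ne_zero (y, t)).hasFDerivAt
    exact h.comp y (hasFDerivAt_prodMk_left y t)

theorem ContDiff.intervalIntegral_param {E F : Type} [NormedAddCommGroup E] [NormedSpace ℝ E]
    [FiniteDimensional ℝ E] [NormedAddCommGroup F] [NormedSpace ℝ F] {f : E × ℝ → F}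
    (hf : ContDiff ℝ (⊤ : ℕ∞) f) (a b : ℝ) :
    ContDiff ℝ (⊤ : ℕ∞) fun x => ∫ t in a..b, f (x, t) := by
  refine contDiff_infty.2 fun n => ?_
  induction n generalizing F with
  | zero =>
    exact contDiff_zero.2 (continuous_iff_continuousAt.2 fun x =>
      (hasFDerivAt_intervalIntegral_of_contDiff (hf.of_le (by exact_mod_cast le_top))
        a b x).continuousAt)
  | succ n ih =>
    refine contDiff_succ_iff_hasFDerivAt.2 ⟨_, ?_, fun x =>
      hasFDerivAt_intervalIntegral_of_contDiff (hf.of_le (by exact_mod_cast le_top)) a b x⟩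
    exact ih (f := fun p => (fderiv ℝ f p).comp (ContinuousLinearMap.inl ℝ E ℝ))
      ((hf.fderiv_right (by simp)).clm_comp contDiff_const)

theorem hasDerivAt_intervalIntegral_of_contDiff {g : ℝ × ℝ → ℝ} {g' : ℝ → ℝ}
    (hg : ContDiff ℝ (⊤ : ℕ∞) g) (a b y : ℝ)
    (hg' : ∀ x, HasDerivAt (fun y => g (x, y)) (g' x) y) :
    HasDerivAt (fun y => ∫ x in a..b, g (x, y)) (∫ x in a..b, g' x) y := by
  have hG : ContDiff ℝ (⊤ : ℕ∞) fun p : ℝ × ℝ => g (p.2, p.1) := hg.comp (by fun_prop)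
  have h := (hasFDerivAt_intervalIntegral_of_contDiff (hG.of_le (by exact_mod_cast le_top))
    a b y).hasDerivAt
  refine h.congr_deriv ?_
  have hc : Continuous fun t : ℝ => (fderiv ℝ (fun p : ℝ × ℝ => g (p.2, p.1)) (y, t)).comp
      (ContinuousLinearMap.inl ℝ ℝ ℝ) :=
    ((hG.continuous_fderiv (by simp)).comp (by fun_prop)).clm_comp continuous_const
  rw [ContinuousLinearMap.intervalIntegral_apply (hc.intervalIntegrable _ _)]
  refine intervalIntegral.integral_congr fun x _ => HasDerivAt.unique ?_ (hg' x)
  have h2 := (hG.differentiable (by simp) (y, x)).hasFDerivAt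
  exact (h2.comp (f := fun z : ℝ => (z, x)) y (hasFDerivAt_prodMk_left (𝕜 := ℝ) y x)).hasDerivAt

/-- A primitive in the first variable of a smooth function of two variables is smooth. -/
theorem ContDiff.intervalIntegral_primitive {g : ℝ × ℝ → ℝ} (hg : ContDiff ℝ (⊤ : ℕ∞) g) (c : ℝ) :
    ContDiff ℝ (⊤ : ℕ∞) fun p : ℝ × ℝ => ∫ x in p.1..c, g (x, p.2) := by
  have h : (fun p : ℝ × ℝ => ∫ x in p.1..c, g (x, p.2)) = fun p : ℝ × ℝ =>
      (c - p.1) * ∫ t in (0 : ℝ)..1, g (p.1 + (c - p.1) * t, p.2) := by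
    funext p
    have := intervalIntegral.mul_integral_comp_add_mul (a := 0) (b := 1)
      (f := fun x => g (x, p.2)) (c - p.1) p.1
    simp [this]
  rw [h]
  refine ContDiff.mul (by fun_prop) (ContDiff.intervalIntegral_param
    (f := fun q : (ℝ × ℝ) × ℝ => g (q.1.1 + (c - q.1.1) * q.2, q.1.2)) ?_ 0 1)
  exact hg.comp (by fun_prop)

/-- The function `(exp (c * t / 2) - 1) / c`, extended smoothly to `c = 0`. -/
def expQuot (c t : ℝ) : ℝ := t / 2 * ∫ x in (0 : ℝ)..1, Real.exp (c * t / 2 * x)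

theorem contDiff_expQuot : ContDiff ℝ (⊤ : ℕ∞) fun p : ℝ × ℝ => expQuot p.1 p.2 := by
  refine ContDiff.mul (by fun_prop) (ContDiff.intervalIntegral_param
    (f := fun q : (ℝ × ℝ) × ℝ => Real.exp (q.1.1 * q.1.2 / 2 * q.2)) ?_ 0 1)
  fun_prop

theorem mul_expQuot (c t : ℝ) : c * expQuot c t = Real.exp (c * t / 2) - 1 := by
  have := intervalIntegral.mul_integral_comp_mul_left (a := 0) (b := 1)
    (f := Real.exp) (c * t / 2)
  rw [integral_exp] at this
  simp only [mul_zero, mul_one, Real.exp_zero] at this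
  rw [← this, expQuot]
  ring

theorem expQuot_zero_left (t : ℝ) : expQuot 0 t = t / 2 := by simp [expQuot]

theorem expQuot_zero_right (c : ℝ) : expQuot c 0 = 0 := by simp [expQuot]

theorem hasDerivAt_expQuot (c t : ℝ) : HasDerivAt (expQuot c) (Real.exp (c * t / 2) / 2) t := by
  rcases eq_or_ne c 0 with rfl | hc
  · have : expQuot 0 = fun t => t / 2 := funext expQuot_zero_left
    rw [this]
    simpa using (hasDerivAt_id t).div_const 2
  · have : expQuot c = fun t => (Real.exp (c * t / 2) - 1) / c := by
      funext t
      rw [← mul_expQuot, mul_div_cancel_left₀ _ hc]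
    rw [this]
    have h := (((((hasDerivAt_id t).const_mul c).div_const 2).exp).sub_const 1).div_const c
    refine h.congr_deriv ?_
    simp only [id, mul_one]
    field_simp

/-- The Jacobian of the characteristic flow along a characteristic with slope `a` and
initial second derivative `b`. -/
def charJac (a b t : ℝ) : ℝ := Real.exp (a * t / 2) - b * expQuot a t

theorem charJac_zero_right (a b : ℝ) : charJac a b 0 = 1 := by simp [charJac, expQuot_zero_right]

theorem charJac_zero_zero (t : ℝ) : charJac 0 0 t = 1 := by simp [charJac]

theorem hasDerivAt_charJac (a b t : ℝ) :
    HasDerivAt (charJac a b) ((a * charJac a b t - b) / 2) t := by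
  have h := (((hasDerivAt_id t).const_mul a).div_const 2).exp.sub
    ((hasDerivAt_expQuot a t).const_mul b)
  refine h.congr_deriv ?_
  have := mul_expQuot a t
  simp only [charJac, id]
  linear_combination (b / 2) * this

theorem continuous_charJac (a b : ℝ) : Continuous (charJac a b) :=
  continuous_iff_continuousAt.2 fun t => (hasDerivAt_charJac a b t).continuousAt

/-- A positive zero of the Jacobian is the critical time appearing in the definition of `τ₀`. -/
theorem eq_of_charJac_eq_zero {a b t : ℝ} (ht : 0 < t) (h : charJac a b t = 0) :
    (a ≠ 0 ∧ 0 < b / (b - a) ∧ 2 / a * Real.log (b / (b - a)) = t) ∨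
      (a = 0 ∧ 0 < b ∧ 2 / b = t) := by
  rcases eq_or_ne a 0 with rfl | ha
  · right
    simp only [charJac, expQuot_zero_left, zero_mul, zero_div, Real.exp_zero] at h
    have hb : b * t = 2 := by linarith
    have hb0 : 0 < b := by
      by_contra! hb'
      nlinarith
    exact ⟨rfl, hb0, by field_simp; linarith⟩
  · left
    have h1 := mul_expQuot a t
    have h2 : (b - a) * Real.exp (a * t / 2) = b := by
      simp only [charJac] at h
      linear_combination (-a) * h - b * h1
    have hba : b - a ≠ 0 := by
      intro h0
      rw [h0, zero_mul] at h2
      exact ha (by linarith)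
    have h3 : b / (b - a) = Real.exp (a * t / 2) := by
      rw [div_eq_iff hba, mul_comm, h2]
    refine ⟨ha, h3 ▸ Real.exp_pos _, ?_⟩
    rw [h3, Real.log_exp]
    field_simp

/-- A smooth family of diffeomorphisms of the line has a smooth family of inverses. -/
theorem exists_contDiffAt_inverse {X J : ℝ → ℝ → ℝ} {T : Set ℝ} (hT : IsOpen T)
    (hX : ContDiff ℝ (⊤ : ℕ∞) fun p : ℝ × ℝ => X p.1 p.2)
    (hXJ : ∀ s t, HasDerivAt (fun s => X s t) (J s t) s)
    (hJ : ∀ t ∈ T, ∀ s, 0 < J s t)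
    (hsurj : ∀ t ∈ T, Function.Surjective fun s => X s t) :
    ∃ S : ℝ → ℝ → ℝ, (∀ t ∈ T, ∀ q s, X s t = q ↔ S q t = s) ∧
      ∀ q, ∀ t ∈ T, ContDiffAt ℝ (⊤ : ℕ∞) (fun p : ℝ × ℝ => S p.1 p.2) (q, t) := by
  have hinj : ∀ t ∈ T, Function.Injective fun s => X s t := fun t ht =>
    (strictMono_of_hasDerivAt_pos (fun s => hXJ s t) (hJ t ht)).injective
  choose! S hS using fun t (ht : t ∈ T) q => hsurj t ht q
  have hiff : ∀ t ∈ T, ∀ q s, X s t = q ↔ S t q = s := fun t ht q s =>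
    ⟨fun h => hinj t ht ((hS t ht q).trans h.symm), fun h => h ▸ hS t ht q⟩
  refine ⟨fun q t => S t q, hiff, fun q t ht => ?_⟩
  set f : (ℝ × ℝ) × ℝ → ℝ := fun p => X p.2 p.1.2 - p.1.1 with hf
  have hfc : ContDiff ℝ (⊤ : ℕ∞) f :=
    (hX.comp (by fun_prop : ContDiff ℝ (⊤ : ℕ∞) fun p : (ℝ × ℝ) × ℝ => (p.2, p.1.2))).sub
      (by fun_prop)
  set u : (ℝ × ℝ) × ℝ := ((q, t), S t q)
  have hd : HasDerivAt (fun s => f ((q, t), s)) (J (S t q) t) (S t q) :=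
    (hXJ (S t q) t).sub_const q
  have hd' := ((hfc.differentiable (by simp) u).hasFDerivAt.comp (S t q)
    (hasFDerivAt_prodMk_right (q, t) (S t q))).hasDerivAt
  have hinv : ((fderiv ℝ f u).comp (ContinuousLinearMap.inr ℝ (ℝ × ℝ) ℝ)).IsInvertible := by
    have h0 : J (S t q) t ≠ 0 := (hJ t ht _).ne'
    refine ⟨ContinuousLinearEquiv.unitsEquivAut ℝ (Units.mk0 _ h0), ?_⟩
    ext
    simpa using hd.unique hd'
  have hcd : ContDiffAt ℝ (⊤ : ℕ∞) f u := hfc.contDiffAt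
  refine (hcd.contDiffAt_implicitFunction (by simp) hinv).congr_of_eventuallyEq ?_
  have hfu : f u = 0 := by simp [hf, u, hS t ht q]
  have hTn : ∀ᶠ p : ℝ × ℝ in nhds (q, t), p.2 ∈ T :=
    continuous_snd.continuousAt.eventually (hT.mem_nhds ht)
  filter_upwards [hcd.eventually_apply_implicitFunction (by simp) hinv, hTn] with p hp hpT
  rw [hfu] at hp
  exact (hiff p.2 hpT p.1 _).1 (by simpa [hf, sub_eq_zero] using hp)

theorem surjective_of_deriv_eq_one {x : ℝ → ℝ} {x' : ℝ → ℝ} {M : ℝ}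
    (hx : ∀ s, HasDerivAt x (x' s) s) (h1 : ∀ s, M ≤ |s| → x' s = 1) :
    Function.Surjective x := by
  have hd : ∀ s, HasDerivAt (fun s => x s - s) (x' s - 1) s := fun s =>
    (hx s).sub (hasDerivAt_id s)
  have hc : Continuous x := continuous_iff_continuousAt.2 fun s => (hx s).continuousAt
  have hcst : ∀ D : Set ℝ, Convex ℝ D → (∀ s ∈ D, M ≤ |s|) → ∀ s ∈ D, ∀ r ∈ D,
      x s - s = x r - r := fun D hD hDM s hs r hr => by
    have := hD.norm_image_sub_le_of_norm_hasDerivWithin_le (C := 0)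
      (fun r _ => (hd r).hasDerivWithinAt) (fun r hr => by simp [h1 r (hDM r hr)]) hr hs
    rwa [zero_mul, norm_le_zero_iff, sub_eq_zero] at this
  have htop : Tendsto x atTop atTop := by
    have : ∀ᶠ s in atTop, s + (x |M| - |M|) = x s := by
      filter_upwards [eventually_ge_atTop |M|] with s hs
      have := hcst (Ici |M|) (convex_Ici _)
        (fun r hr => (le_abs_self M).trans (le_trans hr (le_abs_self r))) s hs _ self_mem_Ici
      linarith
    exact (tendsto_atTop_add_const_right _ _ tendsto_id).congr' this
  have hbot : Tendsto x atBot atBot := by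
    have : ∀ᶠ s in atBot, s + (x (-|M|) + |M|) = x s := by
      filter_upwards [eventually_le_atBot (-|M|)] with s hs
      have := hcst (Iic (-|M|)) (convex_Iic _)
        (fun r hr => (le_abs_self M).trans ((le_neg_of_le_neg hr).trans (neg_le_abs r)))
        s hs _ self_mem_Iic
      linarith
    exact (tendsto_atBot_add_const_right _ _ tendsto_id).congr' this
  exact hc.surjective htop hbot

/-- The smooth solution of the profile equation, built by the method of characteristics on the set
of times for which the characteristic flow is nondegenerate. -/
theorem exists_profile_of_charJac_pos {f : ℝ → ℝ} {M : ℝ} (hf : ContDiff ℝ (⊤ : ℕ∞) f)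
    (hfM : ∀ s, M ≤ s → f s = 0) (ha : ∀ s, M ≤ |s| → deriv f s = 0)
    (hb : ∀ s, M ≤ |s| → deriv (deriv f) s = 0) {I : Set ℝ}
    (hI : ∀ t ∈ I, ∀ s ∈ Icc (-M) M, 0 < charJac (deriv f s) (deriv (deriv f) s) t) :
    ∃ V : ℝ → ℝ → ℝ,
      ContDiffOn ℝ (⊤ : ℕ∞) (fun p : ℝ × ℝ => V p.1 p.2) (univ ×ˢ I) ∧
      (∀ q : ℝ, ∀ τ ∈ I,
        2 * deriv (fun σ => deriv (fun p => V p σ) q) τ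
          + V q τ * iteratedDeriv 2 (fun p => V p τ) q
          - deriv (fun p => V p τ) q * iteratedDeriv 2 (fun p => V p τ) q = 0) ∧
      (∀ q : ℝ, V q 0 = f q) ∧
      (∀ τ ∈ I, ∀ q : ℝ, M < q → V q τ = 0) := by
  set a := deriv f
  set b := deriv a
  have has : ContDiff ℝ (⊤ : ℕ∞) a := (contDiff_infty_iff_deriv.1 hf).2
  have hbs : ContDiff ℝ (⊤ : ℕ∞) b := (contDiff_infty_iff_deriv.1 has).2
  have hda : ∀ s, HasDerivAt a (b s) s := fun s => (has.differentiable (by simp) s).hasDerivAt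
  set J : ℝ → ℝ → ℝ := fun s t => charJac (a s) (b s) t with hJ_def
  have hJs : ContDiff ℝ (⊤ : ℕ∞) fun p : ℝ × ℝ => J p.1 p.2 := by
    have h1 : ContDiff ℝ (⊤ : ℕ∞) fun p : ℝ × ℝ => a p.1 := has.comp contDiff_fst
    have h2 : ContDiff ℝ (⊤ : ℕ∞) fun p : ℝ × ℝ => b p.1 := hbs.comp contDiff_fst
    exact ((h1.mul contDiff_snd).div_const 2).exp.sub
      (h2.mul (contDiff_expQuot.comp (h1.prodMk contDiff_snd)))
  have haJs : ContDiff ℝ (⊤ : ℕ∞) fun p : ℝ × ℝ => a p.1 * J p.1 p.2 :=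
    (has.comp contDiff_fst).mul hJs
  have hJ1 : ∀ s t, M ≤ |s| → J s t = 1 := fun s t hs => by
    simp only [hJ_def, ha s hs, hb s hs, charJac_zero_zero]
  set X : ℝ → ℝ → ℝ := fun s t => M - ∫ x in s..M, J x t with hX_def
  set U : ℝ → ℝ → ℝ := fun s t => -∫ x in s..M, a x * J x t with hU_def
  have hXs : ContDiff ℝ (⊤ : ℕ∞) fun p : ℝ × ℝ => X p.1 p.2 :=
    contDiff_const.sub (ContDiff.intervalIntegral_primitive hJs M)
  have hUs : ContDiff ℝ (⊤ : ℕ∞) fun p : ℝ × ℝ => U p.1 p.2 :=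
    (ContDiff.intervalIntegral_primitive haJs M).neg
  have hprim : ∀ {g : ℝ → ℝ}, Continuous g → ∀ s,
      HasDerivAt (fun s => ∫ x in s..M, g x) (-g s) s := fun hg s =>
    intervalIntegral.integral_hasDerivAt_left (hg.intervalIntegrable _ _)
      (hg.stronglyMeasurableAtFilter _ _) hg.continuousAt
  have hJc : ∀ t, Continuous fun s => J s t := fun t =>
    hJs.continuous.comp (by fun_prop : Continuous fun s : ℝ => (s, t))
  have haJc : ∀ t, Continuous fun s => a s * J s t := fun t => has.continuous.mul (hJc t)
  have hXJ : ∀ s t, HasDerivAt (fun s => X s t) (J s t) s := fun s t => by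
    simpa using (hprim (hJc t) s).const_sub M
  have hUJ : ∀ s t, HasDerivAt (fun s => U s t) (a s * J s t) s := fun s t => by
    exact (hprim (haJc t) s).fun_neg.congr_deriv (neg_neg _)
  have hXt : ∀ s t, HasDerivAt (fun t => X s t) ((U s t - a s) / 2) t := fun s t => by
    have h := (hasDerivAt_intervalIntegral_of_contDiff hJs s M t
      (fun x => hasDerivAt_charJac (a x) (b x) t)).const_sub M
    refine h.congr_deriv ?_
    have h1 : ∫ x in s..M, b x = a M - a s :=
      intervalIntegral.integral_eq_sub_of_hasDerivAt (fun x _ => hda x)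
        (hbs.continuous.intervalIntegrable _ _)
    rw [intervalIntegral.integral_div, intervalIntegral.integral_sub
      ((haJc t).intervalIntegrable _ _) (hbs.continuous.intervalIntegrable _ _), h1,
      ha M (le_abs_self M)]
    simp only [hU_def, hJ_def]
    ring
  have hXright : ∀ s t, M ≤ s → X s t = s := fun s t hs => by
    have : ∫ x in s..M, J x t = ∫ x in s..M, (1 : ℝ) := by
      refine intervalIntegral.integral_congr fun x hx => hJ1 x t ?_
      rw [uIcc_of_ge hs] at hx
      exact hx.1.trans (le_abs_self x)
    simp [hX_def, this]
  have hUright : ∀ s t, M ≤ s → U s t = 0 := fun s t hs => by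
    have : ∫ x in s..M, a x * J x t = ∫ x in s..M, (0 : ℝ) := by
      refine intervalIntegral.integral_congr fun x hx => ?_
      rw [uIcc_of_ge hs] at hx
      simp [ha x (hx.1.trans (le_abs_self x))]
    simp [hU_def, this]
  set T : Set ℝ := {t | ∀ s ∈ Icc (-M) M, 0 < J s t}
  have hTo : IsOpen T := isOpen_iff_eventually.2 fun t ht =>
    isCompact_Icc.eventually_forall_of_forall_eventually fun s hs =>
      (hJs.continuous.comp continuous_swap).continuousAt.eventually (lt_mem_nhds (ht s hs))
  have hTJ : ∀ t ∈ T, ∀ s, 0 < J s t := fun t ht s => by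
    by_cases hs : M ≤ |s|
    · rw [hJ1 s t hs]
      exact one_pos
    · exact ht s (abs_le.1 (not_le.1 hs).le)
  have hIT : I ⊆ T := hI
  have h0T : (0 : ℝ) ∈ T := fun s _ => by
    simp only [hJ_def, charJac_zero_right, one_pos]
  obtain ⟨S, hS, hSs⟩ := exists_contDiffAt_inverse hTo hXs hXJ hTJ fun t _ =>
    surjective_of_deriv_eq_one (fun s => hXJ s t) (fun s => hJ1 s t)
  have hXS : ∀ t ∈ T, ∀ q, X (S q t) t = q := fun t ht q => (hS t ht q _).2 rfl
  have hSq : ∀ t ∈ T, ∀ q, HasDerivAt (fun q => S q t) (J (S q t) t)⁻¹ q := fun t ht q => by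
    have hd : DifferentiableAt ℝ (fun q => S q t) q :=
      ((hSs q t ht).differentiableAt (by simp)).comp (f := fun q => (q, t)) q (by fun_prop)
    have h := (hXJ (S q t) t).comp q hd.hasDerivAt
    have h2 : (fun s => X s t) ∘ (fun q => S q t) = id := funext (hXS t ht)
    rw [h2] at h
    exact hd.hasDerivAt.congr_deriv (eq_inv_of_mul_eq_one_right (h.unique (hasDerivAt_id q)))
  have hSt : ∀ t ∈ T, ∀ q, HasDerivAt (fun t => S q t)
      (-((U (S q t) t - a (S q t)) / 2) / J (S q t) t) t := fun t ht q => by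
    have hd : DifferentiableAt ℝ (fun t => S q t) t :=
      ((hSs q t ht).differentiableAt (by simp)).comp (f := fun t => (q, t)) t (by fun_prop)
    have hF := (hXs.differentiable (by simp) (S q t, t)).hasFDerivAt
    have h1 := (hF.comp (f := fun s : ℝ => (s, t)) (S q t)
      (hasFDerivAt_prodMk_left (𝕜 := ℝ) (S q t) t)).hasDerivAt.unique (hXJ (S q t) t)
    have h2 := (hF.comp (f := fun r : ℝ => (S q t, r)) t
      (hasFDerivAt_prodMk_right (𝕜 := ℝ) (S q t) t)).hasDerivAt.unique (hXt (S q t) t)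
    have h3 := hF.comp_hasDerivAt (f := fun r => (S q r, id r)) t (hd.hasDerivAt.prodMk (hasDerivAt_id t))
    have h4 : ((fun p : ℝ × ℝ => X p.1 p.2) ∘ fun r => (S q r, id r)) =ᶠ[nhds t] fun _ => q := by
      filter_upwards [hTo.mem_nhds ht] with r hr using hXS r hr q
    have h5 := h3.unique ((hasDerivAt_const t q).congr_of_eventuallyEq h4)
    set d := deriv (fun t => S q t) t
    have h6 : ((d, 1) : ℝ × ℝ) = d • (1, 0) + (0, 1) := by simp
    rw [h6, map_add, map_smul] at h5
    simp only [ContinuousLinearMap.comp_apply, ContinuousLinearMap.inl_apply,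
      ContinuousLinearMap.inr_apply] at h1 h2
    rw [h1, h2, smul_eq_mul] at h5
    refine hd.hasDerivAt.congr_deriv ?_
    rw [eq_div_iff (hTJ t ht _).ne']
    linarith
  have hVq : ∀ t ∈ T, ∀ q, HasDerivAt (fun q => U (S q t) t) (a (S q t)) q := fun t ht q => by
    refine ((hUJ (S q t) t).comp q (hSq t ht q)).congr_deriv ?_
    rw [mul_assoc, mul_inv_cancel₀ (hTJ t ht _).ne', mul_one]
  have hVq' : ∀ t ∈ T, deriv (fun q => U (S q t) t) = fun q => a (S q t) := fun t ht =>
    funext fun q => (hVq t ht q).deriv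
  refine ⟨fun q t => U (S q t) t, ?_, ?_, ?_, ?_⟩
  · rintro ⟨q, t⟩ ⟨-, ht⟩
    exact (hUs.contDiffAt.comp (q, t)
      ((hSs q t (hIT ht)).prodMk contDiffAt_snd)).contDiffWithinAt
  · intro q t htI
    have ht := hIT htI
    have h1 : (fun r => deriv (fun p => U (S p r) r) q) =ᶠ[nhds t] fun r => a (S q r) := by
      filter_upwards [hTo.mem_nhds ht] with r hr
      rw [hVq' r hr]
    have h2 := (hda (S q t)).comp t (hSt t ht q)
    have h3 := (hda (S q t)).comp q (hSq t ht q)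
    rw [h1.deriv_eq, iteratedDeriv_succ, iteratedDeriv_one, hVq' t ht]
    erw [h2.deriv, h3.deriv]
    have := (hTJ t ht (S q t)).ne'
    field_simp
    ring
  · intro q
    have hJ0 : ∀ s, J s 0 = 1 := fun s => charJac_zero_right _ _
    have hX0 : X q 0 = q := by simp [hX_def, hJ0]
    have h1 : ∫ x in q..M, a x = f M - f q :=
      intervalIntegral.integral_eq_sub_of_hasDerivAt
        (fun x _ => (hf.differentiable (by simp) x).hasDerivAt)
        (has.continuous.intervalIntegrable _ _)
    simp [(hS 0 h0T q q).1 hX0, hU_def, hJ0, h1, hfM M le_rfl]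
  · intro t ht q hq
    simp only [(hS t (hIT ht) q q).1 (hXright q t hq.le), hUright q t hq.le]

theorem F0_eq_intervalIntegral {u₀ u₁ : ℝ → ℝ} {M : ℝ} (hu₁ : Continuous u₁)
    (hsupp₁ : ∀ s, M < |s| → u₁ s = 0) (s : ℝ) :
    F0 u₀ u₁ s = (1 / 2) * (s * u₀ s + ∫ ρ in s..M, ρ * u₁ ρ) := by
  have hc : Continuous fun ρ => ρ * u₁ ρ := by fun_prop
  have h0 : ∀ ρ, M < ρ → ρ * u₁ ρ = 0 := fun ρ hρ => by
    rw [hsupp₁ ρ (hρ.trans_le (le_abs_self ρ)), mul_zero]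
  have hz : ∫ ρ in Ioi M, ρ * u₁ ρ = 0 := setIntegral_eq_zero_of_forall_eq_zero h0
  have hi : Integrable fun ρ => ρ * u₁ ρ :=
    hc.integrable_of_hasCompactSupport (HasCompactSupport.intro (isCompact_Icc (a := -M) (b := M))
      fun ρ hρ => by
        rw [hsupp₁ ρ (not_le.1 fun h => hρ (abs_le.1 h)), mul_zero])
  rw [F0, ← intervalIntegral.integral_Ioi_sub_Ioi' hi.integrableOn hi.integrableOn, hz, sub_zero]

theorem eq_zero_of_le_abs {g : ℝ → ℝ} {M : ℝ} (hg : Continuous g)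
    (h : ∀ s, M < |s| → g s = 0) (s : ℝ) (hs : M ≤ |s|) : g s = 0 := by
  rcases le_abs'.1 hs with hs | hs
  · have h1 : EqOn g 0 (Iio (-M)) := fun r hr => h r (lt_abs.2 (Or.inr (lt_neg_of_lt_neg hr)))
    exact h1.closure hg continuous_const (by rwa [closure_Iio])
  · have h1 : EqOn g 0 (Ioi M) := fun r hr => h r (lt_abs.2 (Or.inl hr))
    exact h1.closure hg continuous_const (by rwa [closure_Ioi])

theorem deriv_eq_zero_of_lt_abs {g : ℝ → ℝ} {M : ℝ} (h : ∀ s, M < |s| → g s = 0) (s : ℝ)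
    (hs : M < |s|) : deriv g s = 0 := by
  have : g =ᶠ[nhds s] fun _ => 0 := by
    filter_upwards [continuous_abs.continuousAt.eventually (lt_mem_nhds hs)] with r hr using h r hr
  rw [this.deriv_eq, deriv_const]

theorem contDiff_F0 {u₀ u₁ : ℝ → ℝ} {M : ℝ} (hu₀ : ContDiff ℝ (⊤ : ℕ∞) u₀)
    (hu₁ : ContDiff ℝ (⊤ : ℕ∞) u₁) (hsupp₁ : ∀ s, M < |s| → u₁ s = 0) :
    ContDiff ℝ (⊤ : ℕ∞) (F0 u₀ u₁) := by
  rw [funext (F0_eq_intervalIntegral hu₁.continuous hsupp₁)]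
  have h := ContDiff.intervalIntegral_primitive (g := fun p => p.1 * u₁ p.1)
    (contDiff_fst.mul (hu₁.comp contDiff_fst)) M
  exact contDiff_const.mul ((contDiff_id.mul hu₀).add
    (h.comp (contDiff_id.prodMk contDiff_const : ContDiff ℝ (⊤ : ℕ∞) fun s : ℝ => (s, (0 : ℝ)))))

theorem deriv_F0 {u₀ u₁ : ℝ → ℝ} {M : ℝ} (hu₀ : Differentiable ℝ u₀)
    (hu₁ : Continuous u₁) (hsupp₁ : ∀ s, M < |s| → u₁ s = 0) (s : ℝ) :
    deriv (F0 u₀ u₁) s = (1 / 2) * (u₀ s + s * deriv u₀ s - s * u₁ s) := by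
  rw [funext (F0_eq_intervalIntegral hu₁ hsupp₁)]
  have hc : Continuous fun ρ => ρ * u₁ ρ := by fun_prop
  have h := (((hasDerivAt_id s).mul (hu₀ s).hasDerivAt).add
    (intervalIntegral.integral_hasDerivAt_left (hc.intervalIntegrable s M)
      (hc.stronglyMeasurableAtFilter _ _) hc.continuousAt)).const_mul (1 / 2)
  refine h.deriv.trans ?_
  simp only [id]
  ring

theorem charJac_pos_of_mem_Ico_tau0 {M : ℝ} {u₀ u₁ : ℝ → ℝ}
    (ha : ∀ s, M ≤ |s| → deriv (F0 u₀ u₁) s = 0)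
    (hb : ∀ s, M ≤ |s| → deriv (deriv (F0 u₀ u₁)) s = 0) {t : ℝ}
    (ht : t ∈ Ico 0 (tau0 M u₀ u₁)) (s : ℝ) :
    0 < charJac (deriv (F0 u₀ u₁) s) (deriv (deriv (F0 u₀ u₁)) s) t := by
  by_cases hs : M ≤ |s|
  · rw [ha s hs, hb s hs, charJac_zero_zero]
    exact one_pos
  by_contra! hneg
  have hsM : s ∈ Ioo (-M) M := abs_lt.1 (not_le.1 hs)
  obtain ⟨r, ⟨hr0, hrt⟩, hr⟩ := intermediate_value_Icc' ht.1
    (continuous_charJac (deriv (F0 u₀ u₁) s) (deriv (deriv (F0 u₀ u₁)) s)).continuousOn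
    ⟨hneg, (charJac_zero_right _ _).symm ▸ zero_le_one⟩
  have hr0 : 0 < r := hr0.lt_of_ne fun h => by
    rw [← h, charJac_zero_right] at hr
    exact one_ne_zero hr
  refine absurd (hrt.trans_lt ht.2) (not_lt.2 (csInf_le ⟨0, ?_⟩ ?_))
  · rintro _ (⟨x, hx, rfl⟩ | ⟨x, hx, rfl⟩)
    · exact hx.2.2.2.le
    · exact (div_pos two_pos hx.2.2).le
  · rcases eq_of_charJac_eq_zero hr0 hr with ⟨h1, h2, h3⟩ | ⟨h1, h2, h3⟩
    · exact Or.inl ⟨s, ⟨hsM, h1, h2, hr0.trans_eq h3.symm⟩, h3⟩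
    · exact Or.inr ⟨s, ⟨hsM, h1, h2⟩, h3⟩

theorem asymptotic_profile_exists (M : ℝ) (hM : 0 < M) (u₀ u₁ : ℝ → ℝ)
    (hu₀ : ContDiff ℝ (⊤ : ℕ∞) u₀) (hu₁ : ContDiff ℝ (⊤ : ℕ∞) u₁)
    (heven₀ : ∀ s, u₀ (-s) = u₀ s) (heven₁ : ∀ s, u₁ (-s) = u₁ s)
    (hsupp₀ : ∀ s, M < |s| → u₀ s = 0) (hsupp₁ : ∀ s, M < |s| → u₁ s = 0)
    (hne : u₀ ≠ 0 ∨ u₁ ≠ 0) :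
    ∃ V : ℝ → ℝ → ℝ,
      ContDiffOn ℝ (⊤ : ℕ∞) (fun p : ℝ × ℝ => V p.1 p.2)
        ((Set.univ : Set ℝ) ×ˢ Set.Ico 0 (tau0 M u₀ u₁)) ∧
      (∀ q : ℝ, ∀ τ ∈ Set.Ico (0 : ℝ) (tau0 M u₀ u₁),
        2 * deriv (fun σ => deriv (fun p => V p σ) q) τ
          + V q τ * iteratedDeriv 2 (fun p => V p τ) q
          - deriv (fun p => V p τ) q * iteratedDeriv 2 (fun p => V p τ) q = 0) ∧
      (∀ q : ℝ, V q 0 = F0 u₀ u₁ q) ∧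
      (∀ τ ∈ Set.Ico (0 : ℝ) (tau0 M u₀ u₁), ∀ q : ℝ, M < q → V q τ = 0) := by
  have ha' : ∀ s, M < |s| → deriv (F0 u₀ u₁) s = 0 := fun s hs => by
    rw [deriv_F0 (hu₀.differentiable (by simp)) hu₁.continuous hsupp₁, hsupp₀ s hs, hsupp₁ s hs,
      deriv_eq_zero_of_lt_abs hsupp₀ s hs]
    simp
  have hF := contDiff_F0 hu₀ hu₁ hsupp₁
  have hF1 := (contDiff_infty_iff_deriv.1 hF).2
  have hF2 := (contDiff_infty_iff_deriv.1 hF1).2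
  have ha := eq_zero_of_le_abs hF1.continuous ha'
  have hb := eq_zero_of_le_abs hF2.continuous (deriv_eq_zero_of_lt_abs ha')
  refine exists_profile_of_charJac_pos (M := M) hF (fun s hs => ?_) ha hb
    fun t ht s _ => charJac_pos_of_mem_Ico_tau0 ha hb ht s
  rw [F0, eq_zero_of_le_abs hu₀.continuous hsupp₀ s (hs.trans (le_abs_self s)),
    setIntegral_eq_zero_of_forall_eq_zero fun ρ hρ => ?_]
  · simp
  · rw [hsupp₁ ρ ((hs.trans_lt hρ).trans_le (le_abs_self ρ)), mul_zero]
end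
end

section
/- Let u = u(t, r) be a C³ function on an open subset of (0,∞) × (0,∞) with 1 + u + ∂_t u > 0, set c = √(1 + u + ∂_t u), U = r u, L₁ = ∂_t + c∂_r, L₂ = ∂_t − c∂_r, w₁ = L₂∂_r U, w₂ = L₁∂_r U, and suppose ∂_t²U − c²∂_r²U = 0. Then w₁ satisfies L₁w₁ = −(1/(4rc))w₁² + (w₁/(4rc))(w₂ + ∂_t u + (r/c)L₂u) − (w₂/(4rc))(∂_t u + (r/c)L₂u). -/
open Set

noncomputable section

/-- `∂_t` for functions of `(t, r)` -/
def Pt (f : ℝ → ℝ → ℝ) (t r : ℝ) : ℝ := deriv (fun s => f s r) t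

/-- `∂_r` for functions of `(t, r)` -/
def Pr (f : ℝ → ℝ → ℝ) (t r : ℝ) : ℝ := deriv (fun ρ => f t ρ) r

/-- `c = √(1 + u + ∂_t u)` -/
def cfun (u : ℝ → ℝ → ℝ) (t r : ℝ) : ℝ := Real.sqrt (1 + u t r + Pt u t r)

/-- `U = r u` -/
def Ufun (u : ℝ → ℝ → ℝ) (t r : ℝ) : ℝ := r * u t r

/-- `L₁ = ∂_t + c ∂_r` -/
def L1op (u f : ℝ → ℝ → ℝ) (t r : ℝ) : ℝ := Pt f t r + cfun u t r * Pr f t r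

/-- `L₂ = ∂_t - c ∂_r` -/
def L2op (u f : ℝ → ℝ → ℝ) (t r : ℝ) : ℝ := Pt f t r - cfun u t r * Pr f t r

/-- `w₁ = L₂ ∂_r U` -/
def w1 (u : ℝ → ℝ → ℝ) : ℝ → ℝ → ℝ := L2op u (Pr (Ufun u))

/-- `w₂ = L₁ ∂_r U` -/
def w2 (u : ℝ → ℝ → ℝ) : ℝ → ℝ → ℝ := L1op u (Pr (Ufun u))

section PartialDerivatives

variable {Ω : Set (ℝ × ℝ)} {f g : ℝ → ℝ → ℝ} {t r : ℝ}

theorem hasDerivAt_slice_fst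
    (h : DifferentiableAt ℝ (fun p : ℝ × ℝ => f p.1 p.2) (t, r)) :
    HasDerivAt (fun s => f s r) (fderiv ℝ (fun p : ℝ × ℝ => f p.1 p.2) (t, r) (1, 0)) t :=
  HasFDerivAt.comp_hasDerivAt (f := fun s : ℝ => (s, r)) t h.hasFDerivAt
    ((hasDerivAt_id t).prodMk (hasDerivAt_const t r))

theorem hasDerivAt_slice_snd
    (h : DifferentiableAt ℝ (fun p : ℝ × ℝ => f p.1 p.2) (t, r)) :
    HasDerivAt (fun ρ => f t ρ) (fderiv ℝ (fun p : ℝ × ℝ => f p.1 p.2) (t, r) (0, 1)) r :=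
  HasFDerivAt.comp_hasDerivAt (f := fun ρ : ℝ => (t, ρ)) r h.hasFDerivAt
    ((hasDerivAt_const r t).prodMk (hasDerivAt_id r))

theorem hasDerivAt_Pt (h : DifferentiableAt ℝ (fun p : ℝ × ℝ => f p.1 p.2) (t, r)) :
    HasDerivAt (fun s => f s r) (Pt f t r) t :=
  (hasDerivAt_slice_fst h).differentiableAt.hasDerivAt

theorem hasDerivAt_Pr (h : DifferentiableAt ℝ (fun p : ℝ × ℝ => f p.1 p.2) (t, r)) :
    HasDerivAt (fun ρ => f t ρ) (Pr f t r) r :=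
  (hasDerivAt_slice_snd h).differentiableAt.hasDerivAt

theorem Pt_congr_of_isOpen (hΩ : IsOpen Ω) (h : ∀ t r, (t, r) ∈ Ω → f t r = g t r)
    (hp : (t, r) ∈ Ω) : Pt f t r = Pt g t r := by
  refine Filter.EventuallyEq.deriv_eq ?_
  have hc : ContinuousAt (fun s : ℝ => (s, r)) t := by fun_prop
  filter_upwards [hc.preimage_mem_nhds (hΩ.mem_nhds hp)] with s hs using h s r hs

theorem Pr_congr_of_isOpen (hΩ : IsOpen Ω) (h : ∀ t r, (t, r) ∈ Ω → f t r = g t r)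
    (hp : (t, r) ∈ Ω) : Pr f t r = Pr g t r := by
  refine Filter.EventuallyEq.deriv_eq ?_
  have hc : ContinuousAt (fun ρ : ℝ => (t, ρ)) r := by fun_prop
  filter_upwards [hc.preimage_mem_nhds (hΩ.mem_nhds hp)] with ρ hρ using h t ρ hρ

theorem differentiableAt_of_contDiffOn {F : ℝ × ℝ → ℝ} {n : WithTop ℕ∞} {p : ℝ × ℝ}
    (hΩ : IsOpen Ω) (h : ContDiffOn ℝ n F Ω) (hn : n ≠ 0) (hp : p ∈ Ω) :
    DifferentiableAt ℝ F p :=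
  (h.contDiffAt (hΩ.mem_nhds hp)).differentiableAt hn

theorem contDiffOn_Pt {n m : WithTop ℕ∞} (hΩ : IsOpen Ω)
    (h : ContDiffOn ℝ n (fun p : ℝ × ℝ => f p.1 p.2) Ω) (hmn : m + 1 ≤ n) :
    ContDiffOn ℝ m (fun p : ℝ × ℝ => Pt f p.1 p.2) Ω :=
  ((h.fderiv_of_isOpen hΩ hmn).clm_apply contDiffOn_const).congr fun p hp =>
    (hasDerivAt_slice_fst (differentiableAt_of_contDiffOn hΩ h
      (by rintro rfl; simp at hmn) hp)).deriv

theorem contDiffOn_Pr {n m : WithTop ℕ∞} (hΩ : IsOpen Ω)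
    (h : ContDiffOn ℝ n (fun p : ℝ × ℝ => f p.1 p.2) Ω) (hmn : m + 1 ≤ n) :
    ContDiffOn ℝ m (fun p : ℝ × ℝ => Pr f p.1 p.2) Ω :=
  ((h.fderiv_of_isOpen hΩ hmn).clm_apply contDiffOn_const).congr fun p hp =>
    (hasDerivAt_slice_snd (differentiableAt_of_contDiffOn hΩ h
      (by rintro rfl; simp at hmn) hp)).deriv

/-- Mixed partial derivatives of a `C²` function commute. -/
theorem Pr_Pt_comm (hΩ : IsOpen Ω) (h : ContDiffOn ℝ 2 (fun p : ℝ × ℝ => f p.1 p.2) Ω)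
    (hp : (t, r) ∈ Ω) : Pr (Pt f) t r = Pt (Pr f) t r := by
  set F : ℝ × ℝ → ℝ := fun p => f p.1 p.2 with hF
  have hd : ∀ q ∈ Ω, DifferentiableAt ℝ F q := fun q hq =>
    differentiableAt_of_contDiffOn hΩ h two_ne_zero hq
  have hdd : DifferentiableAt ℝ (fderiv ℝ F) (t, r) :=
    ((h.fderiv_of_isOpen hΩ (m := 1) (by norm_num)).contDiffAt
      (hΩ.mem_nhds hp)).differentiableAt one_ne_zero
  have e1 : Pr (Pt f) t r = fderiv ℝ (fderiv ℝ F) (t, r) (0, 1) (1, 0) := by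
    rw [Pr_congr_of_isOpen (f := Pt f) (g := fun t r => fderiv ℝ F (t, r) (1, 0)) hΩ
      (fun t r hq => (hasDerivAt_slice_fst (hd _ hq)).deriv) hp]
    refine (hasDerivAt_slice_snd (f := fun t r => fderiv ℝ F (t, r) (1, 0))
      (hdd.clm_apply (differentiableAt_const _))).deriv.trans ?_
    simp [fderiv_clm_apply hdd (differentiableAt_const _)]
  have e2 : Pt (Pr f) t r = fderiv ℝ (fderiv ℝ F) (t, r) (1, 0) (0, 1) := by
    rw [Pt_congr_of_isOpen (f := Pr f) (g := fun t r => fderiv ℝ F (t, r) (0, 1)) hΩ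
      (fun t r hq => (hasDerivAt_slice_snd (hd _ hq)).deriv) hp]
    refine (hasDerivAt_slice_fst (f := fun t r => fderiv ℝ F (t, r) (0, 1))
      (hdd.clm_apply (differentiableAt_const _))).deriv.trans ?_
    simp [fderiv_clm_apply hdd (differentiableAt_const _)]
  rw [e1, e2]
  exact ((h.contDiffAt (hΩ.mem_nhds hp)).isSymmSndFDerivAt (by simp)) _ _

end PartialDerivatives

theorem riccati_equation_w1 (Ω : Set (ℝ × ℝ)) (hΩ : IsOpen Ω)
    (hΩsub : Ω ⊆ Set.Ioi 0 ×ˢ Set.Ioi 0) (u : ℝ → ℝ → ℝ)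
    (hreg : ContDiffOn ℝ 3 (fun p : ℝ × ℝ => u p.1 p.2) Ω)
    (hpos : ∀ t r : ℝ, (t, r) ∈ Ω → 0 < 1 + u t r + Pt u t r)
    (hwave : ∀ t r : ℝ, (t, r) ∈ Ω →
      Pt (Pt (Ufun u)) t r = (cfun u t r) ^ 2 * Pr (Pr (Ufun u)) t r) :
    ∀ t r : ℝ, (t, r) ∈ Ω →
      L1op u (w1 u) t r =
        -(1 / (4 * r * cfun u t r)) * (w1 u t r) ^ 2
        + (w1 u t r / (4 * r * cfun u t r)) *
            (w2 u t r + Pt u t r + (r / cfun u t r) * L2op u u t r)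
        - (w2 u t r / (4 * r * cfun u t r)) *
            (Pt u t r + (r / cfun u t r) * L2op u u t r) := by
  intro t r hp
  have hr : 0 < r := (hΩsub hp).2
  have hc : 0 < cfun u t r := Real.sqrt_pos.2 (hpos t r hp)
  have hU : ContDiffOn ℝ 3 (fun p : ℝ × ℝ => Ufun u p.1 p.2) Ω := contDiffOn_snd.mul hreg
  have hut := contDiffOn_Pt (m := 2) hΩ hreg (by norm_num)
  have hV := contDiffOn_Pr (m := 2) hΩ hU (by norm_num)
  have hVt := contDiffOn_Pt (m := 1) hΩ hV (by norm_num)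
  have hVr := contDiffOn_Pr (m := 1) hΩ hV (by norm_num)
  have hcd : ContDiffOn ℝ 2 (fun p : ℝ × ℝ => cfun u p.1 p.2) Ω :=
    ((contDiffOn_const.add (hreg.of_le (by norm_num))).add hut).sqrt
      fun p hq => (hpos p.1 p.2 hq).ne'
  have du := differentiableAt_of_contDiffOn hΩ hreg (by norm_num) hp
  have dut := differentiableAt_of_contDiffOn hΩ hut two_ne_zero hp
  have dVt := differentiableAt_of_contDiffOn hΩ hVt one_ne_zero hp
  have dVr := differentiableAt_of_contDiffOn hΩ hVr one_ne_zero hp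
  have dc := differentiableAt_of_contDiffOn hΩ hcd two_ne_zero hp
  have hPtU : Pt (Ufun u) = Ufun (Pt u) := by
    funext t r
    exact deriv_const_mul_field r
  have hc_sq : ∀ t r, (t, r) ∈ Ω → cfun u t r ^ 2 = 1 + u t r + Pt u t r :=
    fun t r hq => Real.sq_sqrt (hpos t r hq).le
  have hct : 2 * cfun u t r * Pt (cfun u) t r = Pt u t r + Pt (Pt u) t r := by
    have h := Pt_congr_of_isOpen (f := fun t r => cfun u t r ^ 2)
      (g := fun t r => 1 + u t r + Pt u t r) hΩ hc_sq hp
    have e1 : Pt (fun t r => cfun u t r ^ 2) t r = _ := ((hasDerivAt_Pt dc).pow 2).deriv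
    have e2 : Pt (fun t r => 1 + u t r + Pt u t r) t r = _ :=
      (((hasDerivAt_Pt du).const_add 1).add (hasDerivAt_Pt dut)).deriv
    rw [e1, e2] at h
    simpa using h
  have hcr : 2 * cfun u t r * Pr (cfun u) t r = Pr u t r + Pr (Pt u) t r := by
    have h := Pr_congr_of_isOpen (f := fun t r => cfun u t r ^ 2)
      (g := fun t r => 1 + u t r + Pt u t r) hΩ hc_sq hp
    have e1 : Pr (fun t r => cfun u t r ^ 2) t r = _ := ((hasDerivAt_Pr dc).pow 2).deriv
    have e2 : Pr (fun t r => 1 + u t r + Pt u t r) t r = _ :=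
      (((hasDerivAt_Pr du).const_add 1).add (hasDerivAt_Pr dut)).deriv
    rw [e1, e2] at h
    simpa using h
  have hUrt : ∀ t r, (t, r) ∈ Ω → Pr (Pt (Ufun u)) t r = Pt (Pr (Ufun u)) t r :=
    fun t r hq => Pr_Pt_comm hΩ (hU.of_le (by norm_num)) hq
  have hVt_eq : Pt (Pr (Ufun u)) t r = Pt u t r + r * Pr (Pt u) t r := by
    rw [← hUrt t r hp, hPtU]
    have h : Pr (Ufun (Pt u)) t r = _ := ((hasDerivAt_id r).mul (hasDerivAt_Pr dut)).deriv
    simpa using h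
  have hUtt : r * Pt (Pt u) t r = cfun u t r ^ 2 * Pr (Pr (Ufun u)) t r := by
    rw [← hwave t r hp, hPtU]
    exact (deriv_const_mul_field r).symm
  have hVtr := Pr_Pt_comm hΩ hV hp
  have hVtt : Pt (Pt (Pr (Ufun u))) t r =
      2 * cfun u t r * Pr (cfun u) t r * Pr (Pr (Ufun u)) t r
        + cfun u t r ^ 2 * Pr (Pr (Pr (Ufun u))) t r := by
    rw [← Pt_congr_of_isOpen hΩ hUrt hp,
      ← Pr_Pt_comm hΩ (contDiffOn_Pt (m := 2) hΩ hU (by norm_num)) hp,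
      Pr_congr_of_isOpen (g := fun t r => cfun u t r ^ 2 * Pr (Pr (Ufun u)) t r) hΩ hwave hp]
    have h : Pr (fun t r => cfun u t r ^ 2 * Pr (Pr (Ufun u)) t r) t r = _ :=
      (((hasDerivAt_Pr dc).pow 2).mul (hasDerivAt_Pr dVr)).deriv
    simpa using h
  have hw1t : Pt (w1 u) t r = Pt (Pt (Pr (Ufun u))) t r
      - (Pt (cfun u) t r * Pr (Pr (Ufun u)) t r + cfun u t r * Pt (Pr (Pr (Ufun u))) t r) :=
    ((hasDerivAt_Pt dVt).sub ((hasDerivAt_Pt dc).mul (hasDerivAt_Pt dVr))).deriv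
  have hw1r : Pr (w1 u) t r = Pr (Pt (Pr (Ufun u))) t r
      - (Pr (cfun u) t r * Pr (Pr (Ufun u)) t r + cfun u t r * Pr (Pr (Pr (Ufun u))) t r) :=
    ((hasDerivAt_Pr dVt).sub ((hasDerivAt_Pr dc).mul (hasDerivAt_Pr dVr))).deriv
  have hL1 : L1op u (w1 u) t r =
      -(Pt (cfun u) t r - cfun u t r * Pr (cfun u) t r) * Pr (Pr (Ufun u)) t r := by
    simp only [L1op, hw1t, hw1r, hVtt, hVtr]
    ring
  rw [hL1]
  simp only [w1, w2, L1op, L2op]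
  generalize cfun u t r = c at *
  generalize Pr (Pr (Ufun u)) t r = Vr at *
  generalize Pt (Pr (Ufun u)) t r = Vt at *
  have hct' : Pt (cfun u) t r = (Pt u t r + c ^ 2 * Vr / r) / (2 * c) := by
    rw [← hUtt]
    field_simp
    linarith
  have hcr' : Pr (cfun u) t r = (Pr u t r + (Vt - Pt u t r) / r) / (2 * c) := by
    rw [hVt_eq, add_sub_cancel_left, mul_div_cancel_left₀ _ hr.ne', ← hcr]
    field_simp
  rw [hct', hcr']
  field_simp
  ring
end
end

section
/- Let b > 0, m₀ > 0, C₀ > 0 be constants. There exists a constant C₁ > 0, depending only on b, m₀, C₀ (and not on ε or T), such that the following holds for every ε ∈ (0, 1) and every T ≤ e^{b/ε} − 1: if r : [0, T] → ℝ is C¹ with r(0) = λ, |λ| ≤ m₀, and r'(t) = c(t) where |c(t) − 1| ≤ C₀ ε (1+t)^{−1} (1 + |t − r(t)|)^{1/2} for all t ∈ [0, T], then |r(t) − t| ≤ C₁ for all t ∈ [0, T]. -/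
open Set

/-- If `‖f'‖ ≤ k (1 + t)⁻¹ √(1 + ‖f‖)` on `[0, T]`, then `1 + ‖f‖` grows at most like
`(1 + t) ^ (2 k)`, here written with the exponential. -/
lemma one_add_norm_le_of_norm_deriv_le_sqrt {E : Type*} [NormedAddCommGroup E] [NormedSpace ℝ E]
    {f f' : ℝ → E} {k T : ℝ} (hk : 0 < k)
    (hf : ∀ t ∈ Icc (0 : ℝ) T, HasDerivAt f (f' t) t)
    (hf' : ∀ t ∈ Icc (0 : ℝ) T, ‖f' t‖ ≤ k * (1 + t)⁻¹ * Real.sqrt (1 + ‖f t‖)) :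
    ∀ t ∈ Icc (0 : ℝ) T, 1 + ‖f t‖ ≤ (1 + ‖f 0‖) * Real.exp (2 * k * Real.log (1 + t)) := by
  set B : ℝ → ℝ := fun t => (1 + ‖f 0‖) * Real.exp (2 * k * Real.log (1 + t)) - 1 with hBdef
  have hB : ∀ t ∈ Icc (0 : ℝ) T, HasDerivAt B (2 * k * (1 + t)⁻¹ * (1 + B t)) t := by
    intro t ht
    have hlog : HasDerivAt (fun s : ℝ => Real.log (1 + s)) (1 / (1 + t)) t :=
      ((hasDerivAt_id t).const_add 1).log (by simp only [id]; linarith [ht.1])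
    refine (((hlog.const_mul (2 * k)).exp.const_mul (1 + ‖f 0‖)).sub_const 1).congr_deriv ?_
    simp only [hBdef]
    ring
  have key := image_norm_le_of_norm_deriv_right_lt_deriv_boundary' (f := f) (f' := f')
    (fun t ht => (hf t ht).continuousAt.continuousWithinAt)
    (fun t ht => (hf t (Ico_subset_Icc_self ht)).hasDerivWithinAt)
    (B := B) (by simp [hBdef])
    (fun t ht => (hB t ht).continuousAt.continuousWithinAt)
    (fun t ht => (hB t (Ico_subset_Icc_self ht)).hasDerivWithinAt)
    (by
      intro t ht hft
      have h := hf' t (Ico_subset_Icc_self ht)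
      have hpos : 0 < k * (1 + t)⁻¹ := mul_pos hk (inv_pos.2 (by linarith [ht.1]))
      have hsqrt : Real.sqrt (1 + ‖f t‖) ≤ 1 + ‖f t‖ :=
        Real.sqrt_le_iff.2 ⟨by positivity, by nlinarith [norm_nonneg (f t)]⟩
      rw [← hft]
      nlinarith [norm_nonneg (f t)])
  intro t ht
  linarith [key ht]

theorem characteristics_stay_close_to_light_rays (b m₀ C₀ : ℝ)
    (hb : 0 < b) (hm₀ : 0 < m₀) (hC₀ : 0 < C₀) :
    ∃ C₁ > 0, ∀ ε ∈ Set.Ioo (0 : ℝ) 1, ∀ T : ℝ, 0 ≤ T → T ≤ Real.exp (b / ε) - 1 →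
      ∀ r c : ℝ → ℝ, ∀ lam : ℝ, r 0 = lam → |lam| ≤ m₀ →
        (∀ t ∈ Set.Icc (0 : ℝ) T, HasDerivAt r (c t) t) →
        (∀ t ∈ Set.Icc (0 : ℝ) T,
          |c t - 1| ≤ C₀ * ε * (1 + t)⁻¹ * Real.sqrt (1 + |t - r t|)) →
        ∀ t ∈ Set.Icc (0 : ℝ) T, |r t - t| ≤ C₁ := by
  refine ⟨(1 + m₀) * Real.exp (2 * C₀ * b), by positivity, ?_⟩
  intro ε hε T _ hT r c lam hr hlam hderiv hc t ht
  have hgrowth := one_add_norm_le_of_norm_deriv_le_sqrt (f := fun t => r t - t)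
    (f' := fun t => c t - 1) (mul_pos hC₀ hε.1)
    (fun s hs => (hderiv s hs).sub (hasDerivAt_id s))
    (fun s hs => by simpa only [Real.norm_eq_abs, abs_sub_comm (r s) s] using hc s hs) t ht
  simp only [Real.norm_eq_abs, sub_zero, hr] at hgrowth
  have hlog : Real.log (1 + t) ≤ b / ε :=
    (Real.log_le_iff_le_exp (by linarith [ht.1])).2 (by linarith [ht.2])
  have hexponent : 2 * (C₀ * ε) * Real.log (1 + t) ≤ 2 * C₀ * b := by
    have := (le_div_iff₀ hε.1).1 hlog
    nlinarith
  have hbound : (1 + |lam|) * Real.exp (2 * (C₀ * ε) * Real.log (1 + t)) ≤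
      (1 + m₀) * Real.exp (2 * C₀ * b) := by gcongr
  linarith
end
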